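/- The Bateman functions of even integer order satisfy the orthogonality relations on (0,∞): ∫₀^∞ k_0(x)² dx = 1/2; for every integer n ≥ 1, ∫₀^∞ k_{2n}(x)² dx = 1; and for all integers m, n ≥ 0 with |m − n| ≥ 2, ∫₀^∞ k_{2m}(x) k_{2n}(x) dx = 0. -/

import Mathlib

/-- The Bateman function `k_ν(x) = (2/π) ∫₀^{π/2} cos(x·tan θ − ν·θ) dθ`. -/
noncomputable def batemanK (ν x : ℝ) : ℝ :=
  (2 / Real.pi) * ∫ θ in (0:ℝ)..(Real.pi / 2), Real.cos (x * Real.tan θ - ν * θ)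

open MeasureTheory Set Filter Topology FourierTransform

/-- The Laplace integrand of a monomial is integrable on the half line. -/
lemma integrableOn_pow_mul_cexp_neg_mul_Ioi (k : ℕ) {s : ℂ} (hs : 0 < s.re) :
    IntegrableOn (fun x : ℝ => (x : ℂ) ^ k * Complex.exp (-s * x)) (Ioi 0) := by
  refine (integrable_norm_iff ?_).mp ?_
  · apply Continuous.aestronglyMeasurable
    fun_prop
  · have h := integrableOn_rpow_mul_exp_neg_mul_rpow (p := 1) (s := k) (b := s.re)
      (by linarith [k.cast_nonneg (α := ℝ)]) one_pos hs
    refine h.congr_fun (fun x hx => ?_) measurableSet_Ioi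
    have hx : 0 < x := hx
    simp [Complex.norm_exp, abs_of_pos hx]

/-- The Laplace transform of a monomial. -/
lemma integral_pow_mul_cexp_neg_mul_Ioi (k : ℕ) {s : ℂ} (hs : 0 < s.re) :
    ∫ x : ℝ in Ioi 0, (x : ℂ) ^ k * Complex.exp (-s * x) = k.factorial / s ^ (k + 1) := by
  have hs0 : s ≠ 0 := by rintro rfl; simp at hs
  induction k with
  | zero =>
    have := integral_exp_mul_complex_Ioi (a := -s) (by simpa using hs) 0
    simpa using this
  | succ k ih =>
    have hd : ∀ x ∈ Ioi (0 : ℝ), HasDerivAt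
        (fun x : ℝ => (x : ℂ) ^ (k + 1) * Complex.exp (-s * x))
        (((k : ℂ) + 1) * ((x : ℂ) ^ k * Complex.exp (-s * x))
          - s * ((x : ℂ) ^ (k + 1) * Complex.exp (-s * x))) x := by
      intro x _
      have h1 : HasDerivAt (fun z : ℂ => z ^ (k + 1) * Complex.exp (-s * z))
          (((k : ℂ) + 1) * ((x : ℂ) ^ k * Complex.exp (-s * x))
          - s * ((x : ℂ) ^ (k + 1) * Complex.exp (-s * x))) (x : ℂ) := by
        convert! (hasDerivAt_pow (k + 1) (x : ℂ)).mul
          (((hasDerivAt_id (x : ℂ)).const_mul (-s)).cexp) using 1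
        simp
        ring
      exact h1.comp_ofReal
    have ht : Tendsto (fun x : ℝ => (x : ℂ) ^ (k + 1) * Complex.exp (-s * x)) atTop (𝓝 0) := by
      rw [tendsto_zero_iff_norm_tendsto_zero]
      refine (tendsto_rpow_mul_exp_neg_mul_atTop_nhds_zero ((k + 1 : ℕ) : ℝ) s.re hs).congr' ?_
      filter_upwards [eventually_gt_atTop 0] with x hx
      rw [Real.rpow_natCast]
      simp [Complex.norm_exp, abs_of_pos hx]
    have i1 := (integrableOn_pow_mul_cexp_neg_mul_Ioi k hs).const_mul ((k : ℂ) + 1)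
    have i2 := (integrableOn_pow_mul_cexp_neg_mul_Ioi (k + 1) hs).const_mul s
    have key := integral_Ioi_of_hasDerivAt_of_tendsto
      (Continuous.continuousWithinAt (by fun_prop)) hd (i1.sub i2) ht
    rw [integral_sub i1 i2, integral_const_mul, integral_const_mul, ih] at key
    simp only [Complex.ofReal_zero, ne_eq, Nat.add_eq_zero_iff, one_ne_zero, and_false,
      not_false_eq_true, zero_pow, zero_mul, sub_zero] at key
    have := sub_eq_zero.mp key
    rw [Nat.factorial_succ, pow_succ s, eq_div_iff (by positivity)]
    push_cast
    rw [mul_comm (s ^ (k+1)), ← mul_assoc, mul_comm _ s, ← this]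
    field_simp

/-- The polynomial `(-1)ⁿ (Lₙ(2x) - Lₙ₋₁(2x))` with `n = m + 1`, where `Lₙ` is the `n`-th Laguerre
polynomial. -/
noncomputable def batemanPoly (m : ℕ) (x : ℝ) : ℝ :=
  ∑ j ∈ Finset.range (m + 1),
    (m.choose j * (-1) ^ (m + j) * 2 ^ (j + 1) / (j + 1).factorial) * x ^ (j + 1)

lemma continuous_batemanPoly (m : ℕ) : Continuous (batemanPoly m) := by
  unfold batemanPoly
  fun_prop

lemma batemanPoly_mul_cexp (m : ℕ) (s : ℂ) (x : ℝ) :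
    (batemanPoly m x : ℂ) * Complex.exp (-s * x) = ∑ j ∈ Finset.range (m + 1),
      ((m.choose j * (-1) ^ (m + j) * 2 ^ (j + 1) / (j + 1).factorial : ℂ)) *
        ((x : ℂ) ^ (j + 1) * Complex.exp (-s * x)) := by
  simp [batemanPoly, Finset.sum_mul, mul_assoc]

lemma integrableOn_batemanPoly_mul_cexp (m : ℕ) {s : ℂ} (hs : 0 < s.re) :
    IntegrableOn (fun x : ℝ => (batemanPoly m x : ℂ) * Complex.exp (-s * x)) (Ioi 0) := by
  simp_rw [batemanPoly_mul_cexp]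
  exact integrable_finsetSum _ fun j _ =>
    (integrableOn_pow_mul_cexp_neg_mul_Ioi (j + 1) hs).const_mul _

lemma integral_batemanPoly_mul_cexp (m : ℕ) {s : ℂ} (hs : 0 < s.re) :
    ∫ x : ℝ in Ioi 0, (batemanPoly m x : ℂ) * Complex.exp (-s * x)
      = 2 * (2 - s) ^ m / s ^ (m + 2) := by
  have hs0 : s ≠ 0 := by rintro rfl; simp at hs
  simp_rw [batemanPoly_mul_cexp]
  rw [integral_finsetSum _ fun j _ =>
    (integrableOn_pow_mul_cexp_neg_mul_Ioi (j + 1) hs).const_mul _]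
  simp_rw [integral_const_mul, integral_pow_mul_cexp_neg_mul_Ioi _ hs]
  rw [sub_eq_add_neg, add_pow, Finset.mul_sum, Finset.sum_div]
  refine Finset.sum_congr rfl fun j hj => ?_
  have hj : j ≤ m := by simpa [Nat.lt_succ_iff] using hj
  obtain ⟨d, rfl⟩ := Nat.exists_eq_add_of_le hj
  have hf : ((j + 1).factorial : ℂ) ≠ 0 := by exact_mod_cast Nat.factorial_ne_zero _
  have hsgn : (-1 : ℂ) ^ (j + d + j) = (-1) ^ d := by
    rw [show j + d + j = 2 * j + d by ring, pow_add, pow_mul]; simp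
  rw [hsgn, Nat.add_sub_cancel_left, neg_pow s]
  field_simp
  ring

lemma measurable_real_tan : Measurable Real.tan := by
  have : Real.tan = fun x => Real.sin x / Real.cos x := funext Real.tan_eq_sin_div_cos
  rw [this]
  exact Real.measurable_sin.div Real.measurable_cos

lemma batemanK_eq_integral_cexp (ν x : ℝ) :
    (batemanK ν x : ℂ) = (1 / Real.pi) * ∫ θ in Ioo (-(Real.pi / 2)) (Real.pi / 2),
      Complex.exp ((x * Real.tan θ - ν * θ : ℝ) * Complex.I) := by
  have hpi := Real.pi_pos
  set F : ℝ → ℂ := fun θ => Complex.exp ((x * Real.tan θ - ν * θ : ℝ) * Complex.I) with hF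
  have hm : Measurable F := by
    have := measurable_real_tan
    fun_prop
  have hi : ∀ a b : ℝ, IntervalIntegrable F volume a b := fun a b =>
    (intervalIntegrable_const (c := (1 : ℝ))).mono_fun hm.aestronglyMeasurable
      (Eventually.of_forall fun θ => by simp only [hF, Complex.norm_exp_ofReal_mul_I]; simp)
  rw [← integral_Ioc_eq_integral_Ioo, ← intervalIntegral.integral_of_le (by linarith),
    ← intervalIntegral.integral_add_adjacent_intervals (hi _ 0) (hi 0 _)]
  have hneg : ∫ θ in (-(Real.pi / 2))..0, F θ = ∫ θ in (0 : ℝ)..(Real.pi / 2), F (-θ) := by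
    simp
  have hi' : IntervalIntegrable (fun θ => F (-θ)) volume 0 (Real.pi / 2) := by
    simpa using (hi 0 (-(Real.pi / 2))).comp_sub_left 0
  rw [hneg, ← intervalIntegral.integral_add hi' (hi _ _), batemanK]
  have hc : ∀ θ, F (-θ) + F θ = ((2 * Real.cos (x * Real.tan θ - ν * θ) : ℝ) : ℂ) := by
    intro θ
    simp only [hF, Real.tan_neg]
    have h2 := Complex.two_cos (x := ((x * Real.tan θ - ν * θ : ℝ) : ℂ))
    rw [Complex.ofReal_mul, Complex.ofReal_cos, Complex.ofReal_ofNat, h2, add_comm]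
    congr 2
    push_cast
    ring
  simp_rw [hc]
  rw [intervalIntegral.integral_ofReal, intervalIntegral.integral_const_mul]
  push_cast
  ring

lemma batemanK_eq_integral_arctan (ν x : ℝ) :
    (batemanK ν x : ℂ) = ∫ w : ℝ, Complex.exp ((2 * Real.pi * (w * x) : ℝ) * Complex.I) *
      (Complex.exp (-(ν * Real.arctan (2 * Real.pi * w)) * Complex.I) *
        (2 / (1 + (2 * Real.pi * w) ^ 2))) := by
  have hpi := Real.pi_pos
  have himg : (fun w : ℝ => Real.arctan (2 * Real.pi * w)) '' univ
      = Ioo (-(Real.pi / 2)) (Real.pi / 2) := by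
    rw [image_univ, ← Real.range_arctan]
    exact (mul_left_surjective₀ (by positivity : 2 * Real.pi ≠ 0)).range_comp Real.arctan
  have hinj : InjOn (fun w : ℝ => Real.arctan (2 * Real.pi * w)) univ := by
    intro a _ b _ h
    exact mul_left_cancel₀ (by positivity) (Real.arctan_injective h)
  have hder : ∀ w ∈ (univ : Set ℝ), HasDerivWithinAt (fun w : ℝ => Real.arctan (2 * Real.pi * w))
      (1 / (1 + (2 * Real.pi * w) ^ 2) * (2 * Real.pi)) univ w := fun w _ => by
    simpa only [mul_one, id_eq] using
      (((hasDerivAt_id w).const_mul (2 * Real.pi)).arctan).hasDerivWithinAt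
  rw [batemanK_eq_integral_cexp, ← himg,
    integral_image_eq_integral_abs_deriv_smul MeasurableSet.univ hder hinj, setIntegral_univ,
    ← integral_const_mul]
  refine integral_congr_ae (Eventually.of_forall fun w => ?_)
  have hp : (0 : ℝ) < 1 + (2 * Real.pi * w) ^ 2 := by positivity
  have hp' : (1 + (2 * Real.pi * w) ^ 2 : ℂ) ≠ 0 := by exact_mod_cast hp.ne'
  have hpi' : (Real.pi : ℂ) ≠ 0 := by exact_mod_cast hpi.ne'
  beta_reduce
  rw [abs_of_pos (by positivity), Real.tan_arctan, ← mul_assoc (Complex.exp _), ← Complex.exp_add,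
    Complex.real_smul]
  generalize Real.arctan (2 * Real.pi * w) = θ
  push_cast
  rw [show (2 * Real.pi * (w * x) * Complex.I + -(ν * θ) * Complex.I : ℂ) =
    (x * (2 * Real.pi * w) - ν * θ) * Complex.I by ring]
  field_simp

/-- A function with the right Fourier transform coincides with the Bateman function. -/
lemma batemanK_eq_of_fourier_eq {f : ℝ → ℂ} {ν : ℝ} (hf : Integrable f)
    (hF : ∀ w : ℝ, 𝓕 f w = Complex.exp (-(ν * Real.arctan (2 * Real.pi * w)) * Complex.I) *
        (2 / (1 + (2 * Real.pi * w) ^ 2))) {x : ℝ} (hx : ContinuousAt f x) :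
    (batemanK ν x : ℂ) = f x := by
  have hFi : Integrable (𝓕 f) := by
    have h1 : Integrable fun w : ℝ => 2 * (1 + (2 * Real.pi * w) ^ 2)⁻¹ :=
      (integrable_inv_one_add_sq.comp_mul_left' (by positivity)).const_mul 2
    refine h1.mono' ?_ (Eventually.of_forall fun w => ?_)
    · rw [funext hF]
      have := Real.measurable_arctan
      exact Measurable.aestronglyMeasurable (by fun_prop)
    · have hp : (0 : ℝ) < 1 + (2 * Real.pi * w) ^ 2 := by positivity
      have e1 : (2 / (1 + (2 * Real.pi * w) ^ 2) : ℂ)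
        = ((2 * (1 + (2 * Real.pi * w) ^ 2)⁻¹ : ℝ) : ℂ) := by push_cast; rfl
      have e2 : (-(ν * Real.arctan (2 * Real.pi * w)) : ℂ)
        = ((-(ν * Real.arctan (2 * Real.pi * w)) : ℝ) : ℂ) := by push_cast; rfl
      rw [hF, norm_mul, e1, e2, Complex.norm_exp_ofReal_mul_I, Complex.norm_real,
        Real.norm_of_nonneg (by positivity), one_mul]
  rw [← hf.fourierInv_fourier_eq hFi hx, Real.fourierInv_eq', batemanK_eq_integral_arctan]
  simp_rw [hF]
  refine integral_congr_ae (Eventually.of_forall fun w => ?_)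
  simp [mul_comm]

lemma cexp_neg_two_mul_arctan (t : ℝ) :
    Complex.exp (-(2 * Real.arctan t) * Complex.I)
      = (1 - t * Complex.I) / (1 + t * Complex.I) := by
  have hc := Real.cos_arctan_pos t
  have hc' : (Real.cos (Real.arctan t) : ℂ) ≠ 0 := by exact_mod_cast hc.ne'
  have ht : (t : ℂ) = Real.sin (Real.arctan t) / Real.cos (Real.arctan t) := by
    rw [← Complex.ofReal_div, ← Real.tan_eq_sin_div_cos, Real.tan_arctan]
  set θ := Real.arctan t
  have e1 : 1 + (t : ℂ) * Complex.I = Complex.exp (θ * Complex.I) / Real.cos θ := by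
    rw [Complex.exp_mul_I, ht]; push_cast at hc' ⊢; field_simp
  have e2 : 1 - (t : ℂ) * Complex.I = Complex.exp (-θ * Complex.I) / Real.cos θ := by
    rw [Complex.exp_mul_I, ht, Complex.cos_neg, Complex.sin_neg]; push_cast at hc' ⊢; field_simp
    ring
  rw [e1, e2, div_div_div_cancel_right₀ hc', ← Complex.exp_sub]
  congr 1
  ring

lemma one_add_mul_I_ne_zero (t : ℝ) : (1 + t * Complex.I : ℂ) ≠ 0 := by
  intro h
  simpa using congrArg Complex.re h

lemma one_sub_mul_I_ne_zero (t : ℝ) : (1 - t * Complex.I : ℂ) ≠ 0 := by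
  intro h
  simpa using congrArg Complex.re h

lemma one_add_sq_eq (t : ℂ) : 1 + t ^ 2 = (1 - t * Complex.I) * (1 + t * Complex.I) := by
  linear_combination t ^ 2 * Complex.I_sq

lemma batemanLaplace_eq (m : ℕ) (t : ℝ) :
    (2 * (2 - (1 + t * Complex.I)) ^ m / (1 + t * Complex.I) ^ (m + 2) : ℂ)
      = Complex.exp (-(2 * (m + 1) * Real.arctan t) * Complex.I) * (2 / (1 + t ^ 2)) := by
  have h1 := one_add_mul_I_ne_zero t
  have h2 := one_sub_mul_I_ne_zero t
  rw [show (-(2 * (m + 1) * Real.arctan t) * Complex.I : ℂ)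
    = ((m + 1 : ℕ) : ℂ) * (-(2 * Real.arctan t) * Complex.I) by push_cast; ring,
    Complex.exp_nat_mul, cexp_neg_two_mul_arctan, one_add_sq_eq,
    show (2 - (1 + t * Complex.I) : ℂ) = 1 - t * Complex.I by ring, div_pow]
  field_simp
  ring

/-- The Bateman function of even positive order on the positive half line. -/
lemma batemanK_two_mul_succ (m : ℕ) {x : ℝ} (hx : 0 < x) :
    batemanK (2 * (m + 1)) x = batemanPoly m x * Real.exp (-x) := by
  set f : ℝ → ℂ := (Ioi (0 : ℝ)).indicator
    fun x => (batemanPoly m x : ℂ) * Complex.exp (-1 * x) with hf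
  have hi : Integrable f :=
    (integrable_indicator_iff measurableSet_Ioi).2
      (integrableOn_batemanPoly_mul_cexp m (by simp))
  have hc : ContinuousAt f x := by
    have : Continuous fun x : ℝ => (batemanPoly m x : ℂ) * Complex.exp (-1 * x) := by
      have := continuous_batemanPoly m
      fun_prop
    refine this.continuousAt.congr ?_
    filter_upwards [Ioi_mem_nhds hx] with y hy
    rw [hf, indicator_of_mem hy]
  have hF : ∀ w : ℝ, 𝓕 f w =
      Complex.exp (-((2 * (m + 1) : ℝ) * Real.arctan (2 * Real.pi * w)) * Complex.I) *
        (2 / (1 + (2 * Real.pi * w) ^ 2)) := by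
    intro w
    have h1 := batemanLaplace_eq m (2 * Real.pi * w)
    rw [← integral_batemanPoly_mul_cexp m (by simp)] at h1
    push_cast at h1 ⊢
    rw [← h1, Real.fourier_real_eq_integral_exp_smul, ← integral_indicator measurableSet_Ioi]
    refine integral_congr_ae (Eventually.of_forall fun v => ?_)
    by_cases hv : v ∈ Ioi (0 : ℝ)
    · simp only [hf, indicator_of_mem hv, smul_eq_mul]
      rw [mul_left_comm, ← Complex.exp_add]
      congr 2
      push_cast
      ring
    · simp only [hf, indicator_of_notMem hv, smul_zero]
  have h := batemanK_eq_of_fourier_eq hi hF hc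
  rw [hf, indicator_of_mem (show x ∈ Ioi 0 from hx)] at h
  have h' : (batemanK (2 * (m + 1)) x : ℂ) = ((batemanPoly m x * Real.exp (-x) : ℝ) : ℂ) := by
    rw [h]; push_cast; simp
  exact_mod_cast h'

lemma batemanK_zero {x : ℝ} (hx : 0 < x) : batemanK 0 x = Real.exp (-x) := by
  set f : ℝ → ℂ := fun x => Complex.exp (-|x| : ℝ) with hf
  have hpos : EqOn f (fun x => Complex.exp (-1 * x)) (Ioi 0) := fun y hy => by
    simp [hf, abs_of_pos (mem_Ioi.1 hy)]
  have hneg : EqOn f (fun x => Complex.exp (1 * x)) (Iic 0) := fun y hy => by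
    simp [hf, abs_of_nonpos (mem_Iic.1 hy)]
  have hi : Integrable f := by
    rw [← integrableOn_univ, ← Iic_union_Ioi (a := (0 : ℝ))]
    exact ((integrableOn_exp_mul_complex_Iic (by simp) 0).congr_fun hneg.symm measurableSet_Iic).union
      ((integrableOn_exp_mul_complex_Ioi (by simp) 0).congr_fun hpos.symm measurableSet_Ioi)
  have hF : ∀ w : ℝ, 𝓕 f w =
      Complex.exp (-((0 : ℝ) * Real.arctan (2 * Real.pi * w)) * Complex.I) *
        (2 / (1 + (2 * Real.pi * w) ^ 2)) := by
    intro w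
    set t : ℝ := 2 * Real.pi * w with ht
    have q1 : EqOn (fun v : ℝ => Complex.exp (↑(-2 * Real.pi * v * w) * Complex.I) • f v)
        (fun v => Complex.exp (-(1 + t * Complex.I) * v)) (Ioi 0) := fun v hv => by
      simp only [hpos hv, smul_eq_mul]
      rw [← Complex.exp_add, ht]
      congr 1
      push_cast
      ring
    have q2 : EqOn (fun v : ℝ => Complex.exp (↑(-2 * Real.pi * v * w) * Complex.I) • f v)
        (fun v => Complex.exp ((1 - t * Complex.I) * v)) (Iic 0) := fun v hv => by
      simp only [hneg hv, smul_eq_mul]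
      rw [← Complex.exp_add, ht]
      congr 1
      push_cast
      ring
    have j1 := integrableOn_exp_mul_complex_Ioi (a := -(1 + t * Complex.I)) (by simp) 0
    have j2 := integrableOn_exp_mul_complex_Iic (a := 1 - t * Complex.I) (by simp) 0
    rw [Real.fourier_real_eq_integral_exp_smul, ← setIntegral_univ, ← Iic_union_Ioi (a := (0 : ℝ)),
      setIntegral_union (Iic_disjoint_Ioi le_rfl) measurableSet_Ioi
        (j2.congr_fun q2.symm measurableSet_Iic) (j1.congr_fun q1.symm measurableSet_Ioi),
      setIntegral_congr_fun measurableSet_Iic q2, setIntegral_congr_fun measurableSet_Ioi q1,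
      integral_exp_mul_complex_Ioi (by simp), integral_exp_mul_complex_Iic (by simp)]
    have h1 := one_add_mul_I_ne_zero t
    have h2 := one_sub_mul_I_ne_zero t
    have h3 : (1 + (2 * Real.pi * w) ^ 2 : ℂ) = (1 - t * Complex.I) * (1 + t * Complex.I) := by
      rw [← one_add_sq_eq, ht]; push_cast; rfl
    rw [h3]
    simp only [Complex.ofReal_zero, mul_zero, Complex.exp_zero, zero_mul, neg_zero, one_mul]
    field_simp
    ring
  have h := batemanK_eq_of_fourier_eq hi hF (x := x) (by
    refine Continuous.continuousAt ?_
    fun_prop)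
  rw [hf] at h
  simp only [abs_of_pos hx] at h
  exact_mod_cast h

lemma integral_mul_batemanK {G : ℝ → ℝ} (hG : IntegrableOn G (Ioi 0)) (ν : ℝ) :
    ∫ x in Ioi (0 : ℝ), G x * batemanK ν x = (2 / Real.pi) * ∫ θ in (0 : ℝ)..(Real.pi / 2),
      ∫ x in Ioi (0 : ℝ), G x * Real.cos (x * Real.tan θ - ν * θ) := by
  have hpi := Real.pi_pos
  have hi : Integrable (Function.uncurry fun x θ : ℝ => G x * Real.cos (x * Real.tan θ - ν * θ))
      ((volume.restrict (Ioi 0)).prod (volume.restrict (Ioc 0 (Real.pi / 2)))) := by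
    have h1 : Integrable (fun p : ℝ × ℝ => G p.1 * 1)
        ((volume.restrict (Ioi 0)).prod (volume.restrict (Ioc 0 (Real.pi / 2)))) :=
      Integrable.mul_prod (f := G) (g := fun _ => (1 : ℝ)) hG (integrable_const 1)
    have hm : Measurable fun p : ℝ × ℝ => Real.cos (p.1 * Real.tan p.2 - ν * p.2) := by
      have := measurable_real_tan
      fun_prop
    simp only [mul_one] at h1
    refine h1.mono (h1.aestronglyMeasurable.mul hm.aestronglyMeasurable)
      (Eventually.of_forall fun p => ?_)
    simp only [Function.uncurry_def, norm_mul]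
    exact mul_le_of_le_one_right (norm_nonneg _) (Real.abs_cos_le_one _)
  rw [intervalIntegral.integral_of_le (by positivity), ← integral_integral_swap hi,
    ← integral_const_mul]
  refine integral_congr_ae (Eventually.of_forall fun x => ?_)
  beta_reduce
  rw [batemanK, intervalIntegral.integral_of_le (by positivity), integral_const_mul]
  ring

lemma integrableOn_batemanPoly_mul_exp (m : ℕ) :
    IntegrableOn (fun x => batemanPoly m x * Real.exp (-x)) (Ioi 0) := by
  have h : IntegrableOn (fun x : ℝ =>
      ((batemanPoly m x : ℂ) * Complex.exp (-1 * x)).re) (Ioi 0) :=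
    (integrableOn_batemanPoly_mul_cexp m (s := 1) (by simp)).re
  refine h.congr_fun (fun x _ => ?_) measurableSet_Ioi
  have : (batemanPoly m x : ℂ) * Complex.exp (-1 * x)
    = ((batemanPoly m x * Real.exp (-x) : ℝ) : ℂ) := by push_cast; simp
  simp only [this]
  exact Complex.ofReal_re _

lemma integral_batemanPoly_mul_cos (m : ℕ) (ν : ℝ) {θ : ℝ}
    (hθ : θ ∈ Ioo (-(Real.pi / 2)) (Real.pi / 2)) :
    ∫ x in Ioi (0 : ℝ), batemanPoly m x * Real.exp (-x) * Real.cos (x * Real.tan θ - ν * θ)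
      = 2 * Real.cos θ ^ 2 * Real.cos ((ν - 2 * (m + 1)) * θ) := by
  have hc := Real.cos_pos_of_mem_Ioo hθ
  have hs : 0 < (1 + Real.tan θ * Complex.I : ℂ).re := by simp [-Complex.ofReal_tan]
  have hL := integral_batemanPoly_mul_cexp m hs
  have hi := (integrableOn_batemanPoly_mul_cexp m hs).const_mul (Complex.exp (ν * θ * Complex.I))
  rw [batemanLaplace_eq, Real.arctan_tan hθ.1 hθ.2] at hL
  have hre := integral_re hi
  rw [integral_const_mul, hL, ← mul_assoc, ← Complex.exp_add] at hre
  have e1 : (2 / (1 + (Real.tan θ : ℂ) ^ 2) : ℂ) = ((2 * Real.cos θ ^ 2 : ℝ) : ℂ) := by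
    rw [← Real.inv_one_add_tan_sq hc.ne']
    push_cast
    rfl
  have e2 : (ν * θ * Complex.I + -(2 * (m + 1) * θ) * Complex.I : ℂ)
      = (((ν - 2 * (m + 1)) * θ : ℝ) : ℂ) * Complex.I := by push_cast; ring
  rw [e1, e2, RCLike.re_to_complex, Complex.re_mul_ofReal, Complex.exp_ofReal_mul_I_re] at hre
  rw [mul_comm (2 * Real.cos θ ^ 2), ← hre]
  refine setIntegral_congr_fun measurableSet_Ioi fun x _ => ?_
  have e3 : Complex.exp (ν * θ * Complex.I) *
      (batemanPoly m x * Complex.exp (-(1 + Real.tan θ * Complex.I) * x)) =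
      Complex.exp ((-(x * Real.tan θ - ν * θ) : ℝ) * Complex.I) *
        ((batemanPoly m x * Real.exp (-x) : ℝ) : ℂ) := by
    rw [mul_left_comm, ← Complex.exp_add,
      Complex.ofReal_mul, Complex.ofReal_exp, mul_left_comm, ← Complex.exp_add]
    congr 2
    push_cast
    ring
  rw [e3, RCLike.re_to_complex, Complex.re_mul_ofReal, Complex.exp_ofReal_mul_I_re, Real.cos_neg]
  ring

lemma integral_cos_two_mul_int (k : ℤ) :
    ∫ θ in (0 : ℝ)..(Real.pi / 2), Real.cos (2 * k * θ) = if k = 0 then Real.pi / 2 else 0 := by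
  split_ifs with hk
  · simp [hk]
  · have hk' : (2 * k : ℝ) ≠ 0 := by exact_mod_cast mul_ne_zero two_ne_zero hk
    rw [intervalIntegral.integral_comp_mul_left (fun y => Real.cos y) hk', integral_cos,
      show (2 * k * (Real.pi / 2) : ℝ) = k * Real.pi by ring, Real.sin_int_mul_pi]
    simp

/-- The Gram matrix of the Bateman functions of even order, for one positive order. -/
lemma integral_batemanK_mul_batemanK (m n : ℕ) :
    ∫ x in Ioi (0 : ℝ), batemanK (2 * (m + 1)) x * batemanK (2 * n) x =
      (if (n : ℤ) - (m + 1) = 0 then 1 else 0) + (if (n : ℤ) - (m + 1) + 1 = 0 then 1 / 2 else 0)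
        + (if (n : ℤ) - (m + 1) - 1 = 0 then 1 / 2 else 0) := by
  have hpi := Real.pi_pos
  rw [setIntegral_congr_fun measurableSet_Ioi (g := fun x =>
    batemanPoly m x * Real.exp (-x) * batemanK (2 * n) x) fun x hx => by
      simp only [batemanK_two_mul_succ m hx],
    integral_mul_batemanK (integrableOn_batemanPoly_mul_exp m)]
  have h : ∀ k : ℤ, IntervalIntegrable (fun θ : ℝ => Real.cos (2 * k * θ)) volume 0 (Real.pi / 2) :=
    fun k => Continuous.intervalIntegrable (by fun_prop) _ _
  set d : ℤ := (n : ℤ) - (m + 1) with hd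
  have hcongr : ∫ θ in (0 : ℝ)..(Real.pi / 2), ∫ x in Ioi (0 : ℝ),
      batemanPoly m x * Real.exp (-x) * Real.cos (x * Real.tan θ - 2 * n * θ) =
      ∫ θ in (0 : ℝ)..(Real.pi / 2), (Real.cos (2 * d * θ) +
        (1 / 2) * Real.cos (2 * (d + 1 : ℤ) * θ) + (1 / 2) * Real.cos (2 * (d - 1 : ℤ) * θ)) := by
    rw [intervalIntegral.integral_of_le (by positivity),
      intervalIntegral.integral_of_le (by positivity), integral_Ioc_eq_integral_Ioo,
      integral_Ioc_eq_integral_Ioo]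
    refine setIntegral_congr_fun measurableSet_Ioo fun θ hθ => ?_
    rw [integral_batemanPoly_mul_cos m _ ⟨by linarith [hθ.1], hθ.2⟩,
      show (2 * n - 2 * (m + 1) : ℝ) * θ = 2 * d * θ by rw [hd]; push_cast; ring,
      show (2 * (d + 1 : ℤ) * θ : ℝ) = 2 * d * θ + 2 * θ by push_cast; ring,
      show (2 * (d - 1 : ℤ) * θ : ℝ) = 2 * d * θ - 2 * θ by push_cast; ring,
      Real.cos_add, Real.cos_sub, Real.cos_two_mul]
    ring
  rw [hcongr, intervalIntegral.integral_add ((h d).add ((h _).const_mul _)) ((h _).const_mul _),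
    intervalIntegral.integral_add (h d) ((h _).const_mul _), intervalIntegral.integral_const_mul,
    intervalIntegral.integral_const_mul]
  simp only [integral_cos_two_mul_int]
  split_ifs <;> field_simp <;> ring

theorem bateman_orthogonality :
    (∫ x in Set.Ioi (0 : ℝ), (batemanK 0 x) ^ 2 = 1 / 2) ∧
    (∀ n : ℕ, 1 ≤ n → ∫ x in Set.Ioi (0 : ℝ), (batemanK (2 * n) x) ^ 2 = 1) ∧
    (∀ m n : ℕ, 2 ≤ |(m : ℤ) - n| →
      ∫ x in Set.Ioi (0 : ℝ), batemanK (2 * m) x * batemanK (2 * n) x = 0) := by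
  have hzero : ∀ m n : ℕ, 2 ≤ |((m + 1 : ℕ) : ℤ) - n| →
      ∫ x in Set.Ioi (0 : ℝ), batemanK (2 * (m + 1 : ℕ)) x * batemanK (2 * n) x = 0 := by
    intro m n h
    have h' := le_abs.1 h
    push_cast at h' ⊢
    rw [integral_batemanK_mul_batemanK, if_neg (by omega), if_neg (by omega), if_neg (by omega)]
    norm_num
  refine ⟨?_, fun n hn => ?_, fun m n h => ?_⟩
  · rw [setIntegral_congr_fun measurableSet_Ioi (g := fun x => Real.exp (-2 * x)) fun x hx => by
      simp only [batemanK_zero hx, ← Real.exp_nat_mul]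
      congr 1
      push_cast
      ring, integral_exp_mul_Ioi (by norm_num)]
    norm_num
  · obtain ⟨m, rfl⟩ := Nat.exists_eq_add_of_le' hn
    have := integral_batemanK_mul_batemanK m (m + 1)
    push_cast at this ⊢
    simpa [sq] using this
  · rcases m with _ | m
    · rcases n with _ | n
      · simp at h
      · simp_rw [mul_comm (batemanK (2 * (0 : ℕ)) _)]
        exact hzero n 0 (by rwa [abs_sub_comm])
    · exact hzero m n h
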